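/- Let d ≥ 1 be an integer, let α₁ be a real number with 0 < α₁ < d, let e₁ be the first standard basis vector of ℝ^d, and let φ be a complex-valued Schwartz function on ℝ^d. Then there exists a constant C = C(d, α₁, φ) > 0 such that for every x ∈ ℝ^d the integral ∫_{ℝ^d} e^{2πi y·e₁}·|y|^{−α₁}·φ(x−y) dy converges absolutely and its modulus is bounded by C·(1+|x|)^{−α₁}. -/

import Mathlib

open MeasureTheory Real
open scoped RealInnerProductSpace

noncomputable section

/-- `ℝ^d` as a Euclidean space. -/
abbrev Euc (d : ℕ) := EuclideanSpace ℝ (Fin d)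

/-- If `P` is small at distance `Z`, then `P` times the Riesz factor `Y ^ (-α)` is controlled by
`(1 + X) ^ (-α)` whenever `X ≤ Y + Z`. -/
lemma rpow_neg_mul_le_of_le_add {α r M P X Y Z : ℝ} (hα : 0 < α) (hr : 0 ≤ r) (hM : 0 ≤ M)
    (hX : 0 ≤ X) (hY : 0 ≤ Y) (hZ : 0 ≤ Z) (hXYZ : X ≤ Y + Z)
    (hP : P ≤ M * ((1 + Z) ^ (-α) * (1 + Z) ^ (-r))) :
    Y ^ (-α) * P ≤
      M * 2 ^ α * ((if Y < 1 then Y ^ (-α) else 0) + (1 + Z) ^ (-r)) * (1 + X) ^ (-α) := by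
  have key {A : ℝ} (hA : 0 < A) (h : 1 + X ≤ A * (1 + Z)) :
      (1 + Z) ^ (-α) ≤ A ^ α * (1 + X) ^ (-α) := by
    have h1 : (A * (1 + Z)) ^ (-α) ≤ (1 + X) ^ (-α) :=
      rpow_le_rpow_of_nonpos (by positivity) h (by linarith)
    rw [mul_rpow hA.le (by positivity), rpow_neg hA.le] at h1
    have hAα : 0 < A ^ α := by positivity
    rwa [inv_mul_le_iff₀ hAα] at h1
  refine (mul_le_mul_of_nonneg_left hP (by positivity)).trans ?_
  split_ifs with h
  · have h2 := key (A := 2) two_pos (by nlinarith)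
    have h3 : (1 + Z) ^ (-r) ≤ 1 := rpow_le_one_of_one_le_of_nonpos (by linarith) (by linarith)
    calc Y ^ (-α) * (M * ((1 + Z) ^ (-α) * (1 + Z) ^ (-r)))
        ≤ Y ^ (-α) * (M * ((2 ^ α * (1 + X) ^ (-α)) * 1)) := by gcongr
      _ = M * 2 ^ α * (Y ^ (-α) + 0) * (1 + X) ^ (-α) := by ring
      _ ≤ _ := by gcongr; positivity
  · have hY1 : 1 ≤ Y := not_lt.mp h
    have hYpos : 0 < Y := by linarith
    have h2 := key (A := 2 * Y) (by positivity) (by nlinarith)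
    calc Y ^ (-α) * (M * ((1 + Z) ^ (-α) * (1 + Z) ^ (-r)))
        ≤ Y ^ (-α) * (M * (((2 * Y) ^ α * (1 + X) ^ (-α)) * (1 + Z) ^ (-r))) := by gcongr
      _ = (Y ^ (-α) * Y ^ α) * (M * 2 ^ α * (0 + (1 + Z) ^ (-r)) * (1 + X) ^ (-α)) := by
        rw [mul_rpow two_pos.le hY]; ring
      _ = _ := by rw [← rpow_add hYpos]; simp

/-- A Schwartz function decays faster than any power of `1 + ‖z‖`. -/
lemma SchwartzMap.exists_norm_le_one_add_norm_rpow {E F : Type*} [NormedAddCommGroup E]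
    [NormedSpace ℝ E] [NormedAddCommGroup F] [NormedSpace ℝ F] (φ : SchwartzMap E F) (k : ℝ) :
    ∃ M : ℝ, 0 < M ∧ ∀ z, ‖φ z‖ ≤ M * (1 + ‖z‖) ^ (-k) := by
  obtain ⟨n, hn⟩ := exists_nat_ge k
  refine ⟨max 1 (2 ^ n * (Finset.Iic (n, 0)).sup (fun m => SchwartzMap.seminorm ℝ m.1 m.2) φ),
    lt_max_of_lt_left one_pos, fun z => ?_⟩
  have h := SchwartzMap.one_add_le_sup_seminorm_apply (𝕜 := ℝ) (m := (n, 0)) le_rfl le_rfl φ z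
  rw [norm_iteratedFDeriv_zero] at h
  have hz : 0 < 1 + ‖z‖ := by positivity
  rw [rpow_neg hz.le, ← div_eq_mul_inv, le_div_iff₀ (by positivity), mul_comm]
  calc (1 + ‖z‖) ^ k * ‖φ z‖ ≤ (1 + ‖z‖) ^ (n : ℝ) * ‖φ z‖ := by
        gcongr
        linarith [norm_nonneg z]
    _ = (1 + ‖z‖) ^ n * ‖φ z‖ := by rw [rpow_natCast]
    _ ≤ _ := h.trans (le_max_right _ _)

/-- **Lemma A.7**: the convolution of the oscillatory Riesz-type kernel
`e^{2πi y·e₁}|y|^{−α₁}` with a Schwartz function decays like `(1+|x|)^{−α₁}`. -/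
theorem oscillatory_kernel_convolution_decay
    (d : ℕ) (hd : 1 ≤ d) (α₁ : ℝ) (hα : α₁ ∈ Set.Ioo (0:ℝ) (d:ℝ))
    (e₁ : Euc d) (he₁ : e₁ = EuclideanSpace.single (⟨0, by omega⟩ : Fin d) (1:ℝ))
    (φ : SchwartzMap (Euc d) ℂ) :
    ∃ C : ℝ, 0 < C ∧ ∀ x : Euc d,
      Integrable (fun y : Euc d =>
          Complex.exp ((↑(2 * Real.pi * ⟪y, e₁⟫) : ℂ) * Complex.I) *
            (↑(‖y‖ ^ (-α₁)) : ℂ) * φ (x - y)) ∧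
      ‖∫ y : Euc d,
          Complex.exp ((↑(2 * Real.pi * ⟪y, e₁⟫) : ℂ) * Complex.I) *
            (↑(‖y‖ ^ (-α₁)) : ℂ) * φ (x - y)‖
        ≤ C * (1 + ‖x‖) ^ (-α₁) := by
  obtain ⟨hα0, hαd⟩ := hα
  obtain ⟨M, hM, hφ⟩ := φ.exists_norm_le_one_add_norm_rpow (α₁ + (d + 1))
  set f : Euc d → ℝ := fun y => if ‖y‖ < 1 then ‖y‖ ^ (-α₁) else 0 with hf
  set g : Euc d → ℝ := fun z => (1 + ‖z‖) ^ (-((d : ℝ) + 1)) with hg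
  have hfint : Integrable f := by
    have h : IntegrableOn (fun y : Euc d => ‖y‖ ^ (-α₁)) (Metric.ball 0 1) :=
      integrableOn_ball_of_norm_le_rpow (C := 1) (α := α₁) (by simpa using hd) (by simpa using hαd)
        (.of_forall fun y => by rw [one_mul, Real.norm_of_nonneg (by positivity)])
        (by apply Measurable.aestronglyMeasurable; fun_prop)
    rw [← integrable_indicator_iff Metric.isOpen_ball.measurableSet] at h
    refine h.congr (.of_forall fun y => ?_)
    simp [hf, Set.indicator]
  have hgint : Integrable g := integrable_one_add_norm (by simp)
  have hf0 (y) : 0 ≤ f y := by simp only [hf]; split_ifs <;> positivity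
  have hg0 (z) : 0 ≤ g z := by positivity
  have hbint (x : Euc d) :
      Integrable fun y => M * 2 ^ α₁ * (f y + g (x - y)) * (1 + ‖x‖) ^ (-α₁) :=
    ((hfint.add (hgint.comp_sub_left x)).const_mul _).mul_const _
  have hbound (x y : Euc d) :
      ‖Complex.exp ((↑(2 * Real.pi * ⟪y, e₁⟫) : ℂ) * Complex.I) *
        (↑(‖y‖ ^ (-α₁)) : ℂ) * φ (x - y)‖
        ≤ M * 2 ^ α₁ * (f y + g (x - y)) * (1 + ‖x‖) ^ (-α₁) := by
    rw [norm_mul, norm_mul, Complex.norm_exp_ofReal_mul_I, one_mul, Complex.norm_real,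
      Real.norm_of_nonneg (by positivity)]
    refine rpow_neg_mul_le_of_le_add hα0 (by positivity) hM.le (norm_nonneg _) (norm_nonneg _)
      (norm_nonneg _) ?_ ?_
    · simpa using norm_add_le y (x - y)
    · rw [← rpow_add (by positivity), ← neg_add]
      exact hφ _
  refine ⟨M * 2 ^ α₁ * ((∫ y, f y) + ∫ z, g z) + 1, ?_, fun x => ⟨?_, ?_⟩⟩
  · have : 0 ≤ ∫ y, f y := integral_nonneg fun y => hf0 y
    have : 0 ≤ ∫ z, g z := integral_nonneg fun z => hg0 z
    positivity
  · refine (hbint x).mono' (Measurable.aestronglyMeasurable ?_) (.of_forall (hbound x))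
    have := φ.continuous.measurable
    fun_prop
  · refine (norm_integral_le_of_norm_le (hbint x) (.of_forall (hbound x))).trans ?_
    rw [integral_mul_const, integral_const_mul,
      integral_add hfint (hgint.comp_sub_left x), integral_sub_left_eq_self g volume x]
    gcongr
    linarith
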